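/- arXiv:2308.09350 — 2 statements merged into one kernel-verified Lean document; each statement's English description precedes it below -/
import Mathlib

section
/- Let Γ ⊂ ℝ^D be a d-dimensional L-Lipschitz graph, p ∈ (1,∞), f ∈ L^p(ℝ^D) nonnegative, and α > 0 with pα > D − d. Then ‖(A_α f)^{1 − (D−d)/(pα)}‖_{L^p(Γ, ℋ^d)} ≤ C(p, α, D, d, L) ‖f‖_{L^p(ℝ^D)}. -/
open MeasureTheory Metric ENNReal NNReal

noncomputable def ballAvg {D : ℕ} (f : EuclideanSpace ℝ (Fin D) → ℝ≥0∞) (ρ : ℝ)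
    (x : EuclideanSpace ℝ (Fin D)) : ℝ≥0∞ :=
  (∫⁻ y in Metric.ball x ρ, f y) / volume (Metric.ball x ρ)

noncomputable def scaleOp {D : ℕ} (α : ℝ) (f : EuclideanSpace ℝ (Fin D) → ℝ≥0∞)
    (x : EuclideanSpace ℝ (Fin D)) : ℝ≥0∞ :=
  sInf {s : ℝ≥0∞ | ∃ ρ : ℝ, 0 < ρ ∧ s = ENNReal.ofReal ρ ∧
    ENNReal.ofReal ρ ^ (-α) < ballAvg f ρ x}

noncomputable def avgOp {D : ℕ} (α : ℝ) (f : EuclideanSpace ℝ (Fin D) → ℝ≥0∞)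
    (x : EuclideanSpace ℝ (Fin D)) : ℝ≥0∞ :=
  scaleOp α f x ^ (-α)

section

variable {D : ℕ}

theorem lintegral_rpow_Ioo {r : ℝ} (hr : 0 < r) {b : ℝ} (hb : 0 ≤ b) :
    ∫⁻ t in Set.Ioo 0 b, ENNReal.ofReal (t ^ (r - 1)) = ENNReal.ofReal (b ^ r / r) := by
  have hi := intervalIntegral.intervalIntegrable_rpow' (a := 0) (b := b) (r := r - 1) (by linarith)
  rw [intervalIntegrable_iff_integrableOn_Ioo_of_le hb] at hi
  rw [← ofReal_integral_eq_lintegral_ofReal hi, ← integral_Ioc_eq_integral_Ioo,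
    ← intervalIntegral.integral_of_le hb, integral_rpow (Or.inl (by linarith)), sub_add_cancel,
    Real.zero_rpow hr.ne', sub_zero]
  filter_upwards [ae_restrict_mem measurableSet_Ioo] with t ht
  exact Real.rpow_nonneg ht.1.le _

theorem lintegral_rpow_indicator_lt {r : ℝ} (hr : 0 < r) (a : ℝ≥0∞) :
    ∫⁻ t in Set.Ioi (0 : ℝ), {t : ℝ | ENNReal.ofReal t < a}.indicator
      (fun t => ENNReal.ofReal (t ^ (r - 1))) t = a ^ r / ENNReal.ofReal r := by
  have hfin : ∀ b : ℝ≥0, ∫⁻ t in Set.Ioi (0 : ℝ), {t : ℝ | ENNReal.ofReal t < b}.indicator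
      (fun t => ENNReal.ofReal (t ^ (r - 1))) t = (b : ℝ≥0∞) ^ r / ENNReal.ofReal r := by
    intro b
    rw [lintegral_indicator (measurableSet_lt (by fun_prop) measurable_const),
      Measure.restrict_restrict (measurableSet_lt (by fun_prop) measurable_const)]
    have : {t : ℝ | ENNReal.ofReal t < b} ∩ Set.Ioi 0 = Set.Ioo 0 (b : ℝ) := by
      ext t
      simp only [Set.mem_inter_iff, Set.mem_ofPred_eq, Set.mem_Ioi, Set.mem_Ioo]
      constructor
      · rintro ⟨h1, h2⟩
        refine ⟨h2, ?_⟩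
        rwa [← ENNReal.ofReal_coe_nnreal, ENNReal.ofReal_lt_ofReal_iff_of_nonneg h2.le] at h1
      · rintro ⟨h1, h2⟩
        refine ⟨?_, h1⟩
        rwa [← ENNReal.ofReal_coe_nnreal, ENNReal.ofReal_lt_ofReal_iff_of_nonneg h1.le]
    rw [this, lintegral_rpow_Ioo hr b.coe_nonneg, ENNReal.ofReal_div_of_pos hr,
      ← ENNReal.ofReal_rpow_of_nonneg b.coe_nonneg hr.le]
    simp
  induction a with
  | coe b => exact hfin b
  | top =>
    rw [ENNReal.top_rpow_of_pos hr, ENNReal.top_div_of_ne_top ENNReal.ofReal_ne_top]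
    refine ENNReal.eq_top_of_forall_nnreal_le fun c => ?_
    have hb := hfin ((c * r.toNNReal) ^ (1 / r))
    have hr' : r.toNNReal ≠ 0 := by simpa using hr
    rw [← ENNReal.coe_rpow_of_nonneg _ hr.le, NNReal.rpow_self_rpow_inv hr.ne', ENNReal.ofReal,
      ← ENNReal.coe_div hr', mul_div_cancel_right₀ _ hr'] at hb
    rw [← hb]
    refine lintegral_mono fun t => Set.indicator_le_indicator_of_subset ?_ (fun _ => zero_le) t
    intro t ht
    exact lt_of_lt_of_le (Set.mem_ofPred_eq ▸ ht) le_top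

theorem isOpen_lt_ballAvg {f : EuclideanSpace ℝ (Fin D) → ℝ≥0∞} {ρ : ℝ} (c : ℝ≥0∞) : IsOpen {x | c < ballAvg f ρ x} := by
  rw [Metric.isOpen_iff]
  intro x hx
  have hmono : Monotone fun n : ℕ => ball x (ρ - 1 / ((n : ℝ) + 1)) := fun i j hij =>
    ball_subset_ball (by linarith [Nat.one_div_le_one_div (α := ℝ) hij])
  have hU : ball x ρ = ⋃ n : ℕ, ball x (ρ - 1 / ((n : ℝ) + 1)) := by
    ext y
    simp only [mem_ball, Set.mem_iUnion]
    constructor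
    · intro h
      obtain ⟨n, hn⟩ := exists_nat_one_div_lt (sub_pos.2 h)
      exact ⟨n, by linarith⟩
    · rintro ⟨n, hn⟩
      have := Nat.one_div_pos_of_nat (α := ℝ) (n := n)
      linarith
  have hx' : c < ballAvg f ρ x := hx
  unfold ballAvg at hx'
  rw [hU, setLIntegral_iUnion_of_directed f hmono.directed_le, ← hU, ENNReal.iSup_div, lt_iSup_iff] at hx'
  obtain ⟨n, hn⟩ := hx'
  refine ⟨1 / ((n : ℝ) + 1), Nat.one_div_pos_of_nat, fun y hy => ?_⟩
  refine hn.trans_le ?_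
  unfold ballAvg
  rw [Measure.addHaar_ball_center volume x, ← Measure.addHaar_ball_center volume y]
  gcongr
  refine ball_subset_ball' ?_
  rw [dist_comm]
  linarith [mem_ball.1 hy]

theorem measurable_avgOp (α : ℝ) (f : EuclideanSpace ℝ (Fin D) → ℝ≥0∞) :
    Measurable (avgOp α f) := by
  refine Measurable.pow_const (measurable_of_Iio fun c => IsOpen.measurableSet ?_) _
  have : scaleOp α f ⁻¹' Set.Iio c = ⋃ ρ ∈ {ρ : ℝ | 0 < ρ ∧ ENNReal.ofReal ρ < c},
      {x | ENNReal.ofReal ρ ^ (-α) < ballAvg f ρ x} := by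
    ext x
    simp only [Set.mem_preimage, Set.mem_Iio, scaleOp, sInf_lt_iff, Set.mem_iUnion,
      Set.mem_ofPred_eq]
    constructor
    · rintro ⟨_, ⟨ρ, h1, rfl, h2⟩, h3⟩
      exact ⟨ρ, ⟨h1, h3⟩, h2⟩
    · rintro ⟨ρ, ⟨h1, h3⟩, h2⟩
      exact ⟨_, ⟨ρ, h1, rfl, h2⟩, h3⟩
  rw [this]
  exact isOpen_biUnion fun ρ _ => isOpen_lt_ballAvg _

theorem le_ofReal_add_mul_indicator {q t h : ℝ} (hq : 1 ≤ q) (hh : 0 < h) (hth : t ≤ h)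
    (a : ℝ≥0∞) :
    a ≤ ENNReal.ofReal (h / 2) + ENNReal.ofReal ((h / 2) ^ (1 - q)) *
      {a : ℝ≥0∞ | ENNReal.ofReal t < 2 * a}.indicator (fun a => a ^ q) a := by
  rcases le_or_gt a (ENNReal.ofReal (h / 2)) with ha | ha
  · exact ha.trans le_self_add
  · refine le_add_left ?_
    have hmem : a ∈ {a : ℝ≥0∞ | ENNReal.ofReal t < 2 * a} := by
      have h2 : 2 * ENNReal.ofReal (h / 2) = ENNReal.ofReal h := by
        rw [← ENNReal.ofReal_ofNat 2, ← ENNReal.ofReal_mul (by norm_num)]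
        congr 1; ring
      calc ENNReal.ofReal t ≤ 2 * ENNReal.ofReal (h / 2) := by
            rw [h2]; exact ENNReal.ofReal_le_ofReal hth
        _ < 2 * a := ENNReal.mul_lt_mul_right two_ne_zero ofNat_ne_top ha
    rw [Set.indicator_of_mem hmem]
    have hpos : 0 < (h / 2) ^ (1 - q) := by positivity
    induction a with
    | top =>
      rw [ENNReal.top_rpow_of_pos (by linarith), ENNReal.mul_top]
      simpa using hpos
    | coe b =>
      have hb : h / 2 < b := by
        rw [← ENNReal.ofReal_coe_nnreal, ENNReal.ofReal_lt_ofReal_iff_of_nonneg (by positivity)] at ha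
        exact ha
      have hb0 : (0 : ℝ) < b := lt_trans (by positivity) hb
      rw [← ENNReal.ofReal_coe_nnreal, ENNReal.ofReal_rpow_of_pos hb0,
        ← ENNReal.ofReal_mul hpos.le]
      refine ENNReal.ofReal_le_ofReal ?_
      calc (b : ℝ) = (b : ℝ) ^ (1 - q) * (b : ℝ) ^ q := by
            rw [← Real.rpow_add hb0]; simp
        _ ≤ _ := by
            gcongr ?_ * _
            exact Real.rpow_le_rpow_of_nonpos (by positivity) hb.le (by linarith)

theorem rpow_scale_le {d : ℕ} {q α t ρ : ℝ} (hα : 0 < α) (ht : 0 < t) (hρ : 0 < ρ)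
    (hqα : (D : ℝ) - d ≤ q * α) (hρt : ρ < t ^ (-(1 / α))) :
    ρ ^ d / ρ ^ D * (ρ ^ (-α) / 2)⁻¹ * (ρ ^ (-α) / 2) ^ (1 - q)
      ≤ 2 ^ q * t ^ (((D : ℝ) - d) / α - q) := by
  have h0 : 0 < ρ ^ (-α) / 2 := by positivity
  rw [mul_assoc, ← Real.rpow_neg_one, ← Real.rpow_add h0,
    Real.div_rpow (by positivity) (by positivity), ← Real.rpow_mul hρ.le, ← Real.rpow_natCast,
    ← Real.rpow_natCast, ← Real.rpow_sub hρ, ← mul_div_assoc, ← Real.rpow_add hρ]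
  have e1 : (d : ℝ) - D + -α * (-1 + (1 - q)) = q * α - (D - d) := by ring
  have e2 : (-1 + (1 - q)) = -q := by ring
  rw [e1, e2, Real.rpow_neg (by norm_num), div_inv_eq_mul, mul_comm]
  gcongr
  calc ρ ^ (q * α - (D - d)) ≤ (t ^ (-(1 / α))) ^ (q * α - (D - d)) := by
        apply Real.rpow_le_rpow hρ.le hρt.le; linarith
    _ = _ := by
        rw [← Real.rpow_mul ht.le]
        congr 1
        field_simp
        ring

theorem ofReal_pow_le_setLIntegral_ball {d : ℕ} {q α t ρ : ℝ} (hα : 0 < α) (hq : 1 ≤ q)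
    (hqα : (D : ℝ) - d ≤ q * α) (ht : 0 < t) (hρ : 0 < ρ) (hρt : ρ < t ^ (-(1 / α)))
    {f : EuclideanSpace ℝ (Fin D) → ℝ≥0∞} {x : EuclideanSpace ℝ (Fin D)}
    (hx : ENNReal.ofReal ρ ^ (-α) < ballAvg f ρ x) :
    ENNReal.ofReal (ρ ^ d) ≤ ENNReal.ofReal (2 ^ q) /
        volume (ball (0 : EuclideanSpace ℝ (Fin D)) 1) *
      ENNReal.ofReal (t ^ (((D : ℝ) - d) / α - q)) * ∫⁻ y in ball x ρ,
        {a : ℝ≥0∞ | ENNReal.ofReal t < 2 * a}.indicator (fun a => a ^ q) (f y) := by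
  set v := volume (ball (0 : EuclideanSpace ℝ (Fin D)) 1) with hv
  have hv0 : v ≠ 0 := (measure_ball_pos _ _ one_pos).ne'
  have hvt : v ≠ ⊤ := measure_ball_lt_top.ne
  set J := ∫⁻ y in ball x ρ,
        {a : ℝ≥0∞ | ENNReal.ofReal t < 2 * a}.indicator (fun a => a ^ q) (f y) with hJ
  have hh : 0 < ρ ^ (-α) := by positivity
  have hth : t ≤ ρ ^ (-α) := by
    have := Real.rpow_le_rpow_of_nonpos hρ hρt.le (neg_nonpos.2 hα.le)
    rwa [← Real.rpow_mul ht.le, show -(1 / α) * -α = 1 by field_simp, Real.rpow_one] at this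
  have hV : volume (ball x ρ) = ENNReal.ofReal (ρ ^ D) * v := by
    rw [Measure.addHaar_ball_of_pos _ _ hρ, finrank_euclideanSpace_fin]
  have hlow : ENNReal.ofReal (ρ ^ (-α) / 2) * volume (ball x ρ) ≤
      ENNReal.ofReal ((ρ ^ (-α) / 2) ^ (1 - q)) * J := by
    have h1 := ENNReal.mul_lt_of_lt_div hx
    have h2 : ∫⁻ y in ball x ρ, f y ≤ ENNReal.ofReal (ρ ^ (-α) / 2) * volume (ball x ρ) +
        ENNReal.ofReal ((ρ ^ (-α) / 2) ^ (1 - q)) * J := by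
      refine (lintegral_mono fun y => le_ofReal_add_mul_indicator hq hh hth (f y)).trans_eq ?_
      rw [lintegral_add_left measurable_const, setLIntegral_const,
        lintegral_const_mul' _ _ ENNReal.ofReal_ne_top]
    rw [ENNReal.ofReal_rpow_of_pos hρ, ← add_halves (ρ ^ (-α)),
      ENNReal.ofReal_add (by positivity) (by positivity), add_mul] at h1
    exact ENNReal.le_of_add_le_add_left
      (ENNReal.mul_ne_top ENNReal.ofReal_ne_top measure_ball_lt_top.ne) (h1.le.trans h2)
  rw [← ENNReal.mul_div_right_comm, ← ENNReal.mul_div_right_comm, ENNReal.le_div_iff_mul_le (.inl hv0) (.inl hvt)]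
  calc ENNReal.ofReal (ρ ^ d) * v
      = ENNReal.ofReal (ρ ^ d / ρ ^ D * (ρ ^ (-α) / 2)⁻¹) *
          (ENNReal.ofReal (ρ ^ (-α) / 2) * volume (ball x ρ)) := by
        rw [hV, ← mul_assoc, ← mul_assoc, ← ENNReal.ofReal_mul (by positivity),
          ← ENNReal.ofReal_mul (by positivity)]
        congr 2
        field_simp
    _ ≤ ENNReal.ofReal (ρ ^ d / ρ ^ D * (ρ ^ (-α) / 2)⁻¹) *
          (ENNReal.ofReal ((ρ ^ (-α) / 2) ^ (1 - q)) * J) := by gcongr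
    _ ≤ ENNReal.ofReal (2 ^ q) * ENNReal.ofReal (t ^ (((D : ℝ) - d) / α - q)) * J := by
        rw [← mul_assoc, ← ENNReal.ofReal_mul (by positivity), ← ENNReal.ofReal_mul (by positivity)]
        exact mul_le_mul_left (ENNReal.ofReal_le_ofReal (rpow_scale_le hα ht hρ hqα hρt)) J

theorem exists_scale_of_lt_avgOp {α t : ℝ} (hα : 0 < α) (ht : 0 < t)
    {f : EuclideanSpace ℝ (Fin D) → ℝ≥0∞} {x : EuclideanSpace ℝ (Fin D)}
    (hx : ENNReal.ofReal t < avgOp α f x) :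
    ∃ ρ : ℝ, 0 < ρ ∧ ρ < t ^ (-(1 / α)) ∧ ENNReal.ofReal ρ ^ (-α) < ballAvg f ρ x := by
  have h : scaleOp α f x < ENNReal.ofReal (t ^ (-(1 / α))) := by
    by_contra! hcon
    refine hx.not_ge ?_
    have := ENNReal.inv_le_inv.2 (ENNReal.rpow_le_rpow hcon hα.le)
    rwa [← ENNReal.rpow_neg, ← ENNReal.rpow_neg, ENNReal.ofReal_rpow_of_pos (by positivity), ← Real.rpow_mul ht.le,
      show -(1 / α) * -α = 1 by field_simp, Real.rpow_one] at this
  obtain ⟨_, ⟨ρ, h1, rfl, h2⟩, h3⟩ := sInf_lt_iff.1 h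
  exact ⟨ρ, h1, (ENNReal.ofReal_lt_ofReal_iff_of_nonneg h1.le).1 h3, h2⟩

theorem measure_lt_avgOp_le {d : ℕ} {K : ℝ≥0} {ν : Measure (EuclideanSpace ℝ (Fin D))}
    (hν : ∀ x r, 0 < r → ν (closedBall x r) ≤ K * ENNReal.ofReal (r ^ d))
    {q α t : ℝ} (hα : 0 < α) (hq : 1 ≤ q) (hqα : (D : ℝ) - d ≤ q * α) (ht : 0 < t)
    (f : EuclideanSpace ℝ (Fin D) → ℝ≥0∞) :
    ν {x | ENNReal.ofReal t < avgOp α f x} ≤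
      K * ENNReal.ofReal (5 ^ d) * (ENNReal.ofReal (2 ^ q) /
          volume (ball (0 : EuclideanSpace ℝ (Fin D)) 1)) *
        ENNReal.ofReal (t ^ (((D : ℝ) - d) / α - q)) *
        ∫⁻ y, {a : ℝ≥0∞ | ENNReal.ofReal t < 2 * a}.indicator (fun a => a ^ q) (f y) := by
  choose! ρ hρ0 hρt hρ using fun x (hx : x ∈ {x | ENNReal.ofReal t < avgOp α f x}) =>
    exists_scale_of_lt_avgOp hα ht hx
  obtain ⟨u, hut, hdisj, hcov⟩ := Vitali.exists_disjoint_subfamily_covering_enlargement_closedBall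
    {x | ENNReal.ofReal t < avgOp α f x} id ρ _ (fun x hx => (hρt x hx).le) 5 (by norm_num)
  simp only [id_eq] at hdisj hcov
  have hdisj' : u.PairwiseDisjoint fun a => ball a (ρ a) :=
    hdisj.mono fun a => ball_subset_closedBall
  have hu : u.Countable := hdisj'.countable_of_isOpen (fun _ _ => isOpen_ball)
    fun a ha => nonempty_ball.2 (hρ0 a (hut ha))
  have hsub : {x | ENNReal.ofReal t < avgOp α f x} ⊆ ⋃ b ∈ u, closedBall b (5 * ρ b) := by
    intro a ha
    obtain ⟨b, hb, hab⟩ := hcov a ha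
    exact Set.mem_biUnion hb (hab (mem_closedBall_self (hρ0 a ha).le))
  have : Countable u := hu.to_subtype
  set F := fun y => {a : ℝ≥0∞ | ENNReal.ofReal t < 2 * a}.indicator (fun a => a ^ q) (f y)
  set c := ENNReal.ofReal (2 ^ q) / volume (ball (0 : EuclideanSpace ℝ (Fin D)) 1)
  set T := ENNReal.ofReal (t ^ (((D : ℝ) - d) / α - q))
  calc ν {x | ENNReal.ofReal t < avgOp α f x}
      ≤ ν (⋃ b ∈ u, closedBall b (5 * ρ b)) := measure_mono hsub
    _ ≤ ∑' b : u, ν (closedBall (b : EuclideanSpace ℝ (Fin D)) (5 * ρ b)) :=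
        measure_biUnion_le ν hu _
    _ ≤ ∑' b : u, K * ENNReal.ofReal (5 ^ d) * c * T * ∫⁻ y in ball (b : EuclideanSpace ℝ (Fin D)) (ρ b), F y := by
        refine ENNReal.tsum_le_tsum fun b => ?_
        have hb := hρ0 b (hut b.2)
        refine (hν b (5 * ρ b) (by linarith)).trans ?_
        rw [mul_pow, ENNReal.ofReal_mul (by positivity)]
        have := ofReal_pow_le_setLIntegral_ball hα hq hqα ht hb (hρt b (hut b.2)) (hρ b (hut b.2))
        calc _ ≤ (K : ℝ≥0∞) * (ENNReal.ofReal (5 ^ d) * (c * T * ∫⁻ y in ball (b : EuclideanSpace ℝ (Fin D)) (ρ b), F y)) := by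
              gcongr
          _ = _ := by ring
    _ = K * ENNReal.ofReal (5 ^ d) * c * T * ∫⁻ y in ⋃ b : u, ball (b : EuclideanSpace ℝ (Fin D)) (ρ b), F y := by
        rw [ENNReal.tsum_mul_left, lintegral_iUnion (fun _ => measurableSet_ball)
          (hdisj'.subtype _ _)]
    _ ≤ _ := by
        gcongr
        exact Measure.restrict_le_self

theorem lintegral_avgOp_rpow_le {d : ℕ} {K : ℝ≥0} {ν : Measure (EuclideanSpace ℝ (Fin D))}
    (hν : ∀ x r, 0 < r → ν (closedBall x r) ≤ K * ENNReal.ofReal (r ^ d))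
    {p q α : ℝ} (hα : 0 < α) (hq : 1 ≤ q) (hqα : (D : ℝ) - d ≤ q * α) (hqp : q < p)
    {f : EuclideanSpace ℝ (Fin D) → ℝ≥0∞} (hf : Measurable f) :
    ∫⁻ x, avgOp α f x ^ (p - ((D : ℝ) - d) / α) ∂ν ≤
      ENNReal.ofReal (p - ((D : ℝ) - d) / α) * (K * ENNReal.ofReal (5 ^ d) *
        (ENNReal.ofReal (2 ^ q) / volume (ball (0 : EuclideanSpace ℝ (Fin D)) 1))) *
        (2 ^ (p - q) / ENNReal.ofReal (p - q)) * ∫⁻ y, f y ^ p := by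
  set r := p - ((D : ℝ) - d) / α with hr_def
  have hr : 0 < r := by
    have : ((D : ℝ) - d) / α ≤ q := (div_le_iff₀ hα).2 hqα
    linarith
  have hpq : 0 < p - q := by linarith
  have : IsLocallyFiniteMeasure ν := ⟨fun x => ⟨closedBall x 1, closedBall_mem_nhds x one_pos,
    (hν x 1 one_pos).trans_lt (ENNReal.mul_lt_top coe_lt_top ofReal_lt_top)⟩⟩
  have hA := measurable_avgOp α f
  set C := K * ENNReal.ofReal (5 ^ d) *
        (ENNReal.ofReal (2 ^ q) / volume (ball (0 : EuclideanSpace ℝ (Fin D)) 1)) with hC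
  have hCt : C ≠ ⊤ := ENNReal.mul_ne_top (ENNReal.mul_ne_top coe_ne_top ofReal_ne_top)
    (ENNReal.div_ne_top ofReal_ne_top (measure_ball_pos _ _ one_pos).ne')
  have hmeas1 : Measurable fun z : EuclideanSpace ℝ (Fin D) × ℝ =>
      {t : ℝ | ENNReal.ofReal t < avgOp α f z.1}.indicator
        (fun t => ENNReal.ofReal (t ^ (r - 1))) z.2 :=
    Measurable.indicator (s := {z : EuclideanSpace ℝ (Fin D) × ℝ |
      ENNReal.ofReal z.2 < avgOp α f z.1}) (f := fun z => ENNReal.ofReal (z.2 ^ (r - 1)))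
      (by fun_prop) (measurableSet_lt (by fun_prop) (by fun_prop))
  have hmeas2 : Measurable fun z : ℝ × EuclideanSpace ℝ (Fin D) =>
      {t : ℝ | ENNReal.ofReal t < 2 * f z.2}.indicator
        (fun t => ENNReal.ofReal (t ^ (p - q - 1))) z.1 * f z.2 ^ q :=
    (Measurable.indicator (s := {z : ℝ × EuclideanSpace ℝ (Fin D) |
      ENNReal.ofReal z.1 < 2 * f z.2}) (f := fun z => ENNReal.ofReal (z.1 ^ (p - q - 1)))
      (by fun_prop) (measurableSet_lt (by fun_prop) (by fun_prop))).mul (by fun_prop)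
  calc ∫⁻ x, avgOp α f x ^ r ∂ν
      = ∫⁻ x, (ENNReal.ofReal r * ∫⁻ t in Set.Ioi (0 : ℝ),
          {t : ℝ | ENNReal.ofReal t < avgOp α f x}.indicator
            (fun t => ENNReal.ofReal (t ^ (r - 1))) t) ∂ν := by
        refine lintegral_congr fun x => ?_
        rw [lintegral_rpow_indicator_lt hr, ENNReal.mul_div_cancel (by simpa using hr) ofReal_ne_top]
    _ = ENNReal.ofReal r * ∫⁻ t in Set.Ioi (0 : ℝ), ∫⁻ x,
          {t : ℝ | ENNReal.ofReal t < avgOp α f x}.indicator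
            (fun t => ENNReal.ofReal (t ^ (r - 1))) t ∂ν := by
        rw [lintegral_const_mul' _ _ ofReal_ne_top, lintegral_lintegral_swap hmeas1.aemeasurable]
    _ ≤ ENNReal.ofReal r * ∫⁻ t in Set.Ioi (0 : ℝ), C * ∫⁻ y,
          {t : ℝ | ENNReal.ofReal t < 2 * f y}.indicator
            (fun t => ENNReal.ofReal (t ^ (p - q - 1))) t * f y ^ q := by
        gcongr ENNReal.ofReal r * ?_
        refine setLIntegral_mono' measurableSet_Ioi fun t ht => ?_
        have ht0 : 0 < t := ht
        have h1 : ∫⁻ x, {t : ℝ | ENNReal.ofReal t < avgOp α f x}.indicator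
            (fun t => ENNReal.ofReal (t ^ (r - 1))) t ∂ν =
            ENNReal.ofReal (t ^ (r - 1)) * ν {x | ENNReal.ofReal t < avgOp α f x} :=
          lintegral_indicator_const (measurableSet_lt measurable_const hA) _
        have h2 : ∫⁻ y, {t : ℝ | ENNReal.ofReal t < 2 * f y}.indicator
            (fun t => ENNReal.ofReal (t ^ (p - q - 1))) t * f y ^ q =
            ENNReal.ofReal (t ^ (p - q - 1)) * ∫⁻ y,
              {a : ℝ≥0∞ | ENNReal.ofReal t < 2 * a}.indicator (fun a => a ^ q) (f y) := by
          rw [← lintegral_const_mul' _ _ ofReal_ne_top]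
          refine lintegral_congr fun y => ?_
          by_cases hy : ENNReal.ofReal t < 2 * f y
          · rw [Set.indicator_of_mem (by exact hy), Set.indicator_of_mem (by exact hy)]
          · rw [Set.indicator_of_notMem (by exact hy), Set.indicator_of_notMem (by exact hy),
              zero_mul, mul_zero]
        rw [h1, h2]
        refine (mul_le_mul_right (measure_lt_avgOp_le hν hα hq hqα ht0 f) _).trans_eq ?_
        rw [← hC, show p - q - 1 = (r - 1) + (((D : ℝ) - d) / α - q) by rw [hr_def]; ring,
          Real.rpow_add ht0, ENNReal.ofReal_mul (by positivity)]
        ring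
    _ = ENNReal.ofReal r * C * ∫⁻ y, ∫⁻ t in Set.Ioi (0 : ℝ),
          {t : ℝ | ENNReal.ofReal t < 2 * f y}.indicator
            (fun t => ENNReal.ofReal (t ^ (p - q - 1))) t * f y ^ q := by
        rw [lintegral_const_mul' _ _ hCt, lintegral_lintegral_swap hmeas2.aemeasurable,
          mul_assoc (ENNReal.ofReal r)]
    _ = ENNReal.ofReal r * C * ∫⁻ y, (2 ^ (p - q) / ENNReal.ofReal (p - q)) * f y ^ p := by
        congr 1
        refine lintegral_congr fun y => ?_
        rw [lintegral_mul_const _ (by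
          exact Measurable.indicator (by fun_prop) (measurableSet_lt (by fun_prop) measurable_const)),
          lintegral_rpow_indicator_lt hpq, ENNReal.mul_rpow_of_nonneg _ _ hpq.le,
          show f y ^ p = f y ^ (p - q) * f y ^ q by
            rw [← ENNReal.rpow_add_of_nonneg _ _ hpq.le (by linarith), sub_add_cancel]]
        simp only [div_eq_mul_inv]
        ring
    _ = _ := by
        rw [lintegral_const_mul _ (hf.pow_const p), ← mul_assoc]

end

theorem hausdorffMeasure_closedBall_le (d : ℕ) :
    ∃ K : ℝ≥0, ∀ (x : EuclideanSpace ℝ (Fin d)) (r : ℝ), 0 < r →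
      Measure.hausdorffMeasure (d : ℝ) (closedBall x r) ≤ K * ENNReal.ofReal (r ^ d) := by
  refine ⟨((d : ℝ≥0) ^ (1 / (2 : ℝ≥0∞)).toReal) ^ (d : ℝ) *
    ((2 : ℝ) ^ d).toNNReal, fun x r hr => ?_⟩
  · have hsub : closedBall x r ⊆ (WithLp.toLp 2 : (Fin d → ℝ) → EuclideanSpace ℝ (Fin d)) ''
        closedBall (WithLp.ofLp x) r := by
      intro y hy
      refine ⟨WithLp.ofLp y, ?_, rfl⟩
      have := (PiLp.lipschitzWith_ofLp 2 (fun _ : Fin d => ℝ)).dist_le_mul y x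
      simp only [NNReal.coe_one, one_mul] at this
      exact this.trans hy
    have h1 := (PiLp.lipschitzWith_toLp 2 (fun _ : Fin d => ℝ)).hausdorffMeasure_image_le
      (d := (d : ℝ)) (by positivity) (closedBall (WithLp.ofLp x) r)
    have h2 : (Measure.hausdorffMeasure (d : ℝ) : Measure (Fin d → ℝ)) = volume := by
      simpa using hausdorffMeasure_pi_real (ι := Fin d)
    rw [h2, Real.volume_pi_closedBall _ hr.le, Fintype.card_fin, mul_pow,
      ENNReal.ofReal_mul (by positivity), ← mul_assoc, ← ENNReal.coe_rpow_of_nonneg _ (by positivity),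
      ENNReal.ofReal, ← ENNReal.coe_mul] at h1
    exact (measure_mono hsub).trans h1

theorem hausdorffMeasure_graph_inter_closedBall_le (D d m : ℕ) (L : ℝ≥0) :
    ∃ K : ℝ≥0, ∀ (e : EuclideanSpace ℝ (Fin D) ≃ₗᵢ[ℝ]
          WithLp 2 (EuclideanSpace ℝ (Fin d) × EuclideanSpace ℝ (Fin m)))
        (U : Set (EuclideanSpace ℝ (Fin d)))
        (g : EuclideanSpace ℝ (Fin d) → EuclideanSpace ℝ (Fin m)),
        LipschitzOnWith L g U → ∀ (x : EuclideanSpace ℝ (Fin D)) (r : ℝ), 0 < r →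
      Measure.hausdorffMeasure (d : ℝ) (closedBall x r ∩ {x : EuclideanSpace ℝ (Fin D) |
              (WithLp.equiv 2 (EuclideanSpace ℝ (Fin d) × EuclideanSpace ℝ (Fin m)) (e x)).1 ∈ U ∧
              (WithLp.equiv 2 (EuclideanSpace ℝ (Fin d) × EuclideanSpace ℝ (Fin m)) (e x)).2 =
                g (WithLp.equiv 2 (EuclideanSpace ℝ (Fin d) × EuclideanSpace ℝ (Fin m)) (e x)).1})
        ≤ K * ENNReal.ofReal (r ^ d) := by
  obtain ⟨K₀, hK₀⟩ := hausdorffMeasure_closedBall_le d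
  refine ⟨(1 * 2 ^ (1 / (2 : ℝ≥0∞)).toReal * max 1 L) ^ (d : ℝ) * K₀,
    fun e U g hg x r hr => ?_⟩
  · have hφ := ((e.symm.isometry.lipschitz.comp
      (WithLp.prod_lipschitzWith_toLp 2 (EuclideanSpace ℝ (Fin d))
        (EuclideanSpace ℝ (Fin m)))).comp_lipschitzOnWith
          (LipschitzOnWith.prodMk (LipschitzWith.id.lipschitzOnWith (s := U)) hg)).mono
        (Set.inter_subset_left (t := closedBall (e x).fst r))
    have h1 := hφ.hausdorffMeasure_image_le (d := (d : ℝ)) (by positivity)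
    refine (measure_mono ?_).trans (h1.trans ((mul_le_mul_right ((measure_mono
      Set.inter_subset_right).trans (hK₀ (e x).fst r hr)) _).trans_eq ?_))
    · rintro y ⟨hy, hyU, hyg⟩
      refine ⟨(e y).fst, ⟨hyU, ?_⟩, ?_⟩
      · have h3 : dist (e y) (e x) ≤ r := by rw [e.isometry.dist_eq]; exact hy
        have h4 := (WithLp.prod_lipschitzWith_ofLp 2 (EuclideanSpace ℝ (Fin d))
          (EuclideanSpace ℝ (Fin m))).dist_le_mul (e y) (e x)
        rw [NNReal.coe_one, one_mul] at h4
        exact (le_max_left _ _).trans (h4.trans h3)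
      · simp only [Function.comp_apply, id_eq]
        rw [LinearIsometryEquiv.symm_apply_eq]
        apply WithLp.ofLp_injective
        exact Prod.ext rfl hyg.symm
    · rw [← mul_assoc, ← ENNReal.coe_rpow_of_nonneg _ (by positivity), ← ENNReal.coe_mul]

theorem stmt8 (D d m : ℕ) (hD : D = d + m) (L : ℝ≥0) {p α : ℝ} (hp : 1 < p)
    (hα : 0 < α) (hpα : (D : ℝ) - d < p * α) :
    ∃ C : ℝ≥0∞, 0 < C ∧ C < ⊤ ∧
      ∀ (e : EuclideanSpace ℝ (Fin D) ≃ₗᵢ[ℝ]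
          WithLp 2 (EuclideanSpace ℝ (Fin d) × EuclideanSpace ℝ (Fin m)))
        (U : Set (EuclideanSpace ℝ (Fin d)))
        (g : EuclideanSpace ℝ (Fin d) → EuclideanSpace ℝ (Fin m)),
        LipschitzOnWith L g U →
        ∀ f : EuclideanSpace ℝ (Fin D) → ℝ≥0∞, Measurable f →
        (∫⁻ y, f y ^ p) < ⊤ →
        (∫⁻ x in {x : EuclideanSpace ℝ (Fin D) |
              (WithLp.equiv 2 (EuclideanSpace ℝ (Fin d) × EuclideanSpace ℝ (Fin m)) (e x)).1 ∈ U ∧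
              (WithLp.equiv 2 (EuclideanSpace ℝ (Fin d) × EuclideanSpace ℝ (Fin m)) (e x)).2 =
                g (WithLp.equiv 2 (EuclideanSpace ℝ (Fin d) × EuclideanSpace ℝ (Fin m)) (e x)).1},
            ((avgOp α f x) ^ (1 - ((D : ℝ) - d) / (p * α))) ^ p
            ∂(MeasureTheory.Measure.hausdorffMeasure (d : ℝ))) ^ (1 / p)
          ≤ C * (∫⁻ y, f y ^ p) ^ (1 / p) := by
  obtain ⟨K, hK⟩ := hausdorffMeasure_graph_inter_closedBall_le D d m L
  have hp0 : 0 < p := by linarith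
  have hMp : ((D : ℝ) - d) / α < p := (div_lt_iff₀ hα).2 hpα
  set q := max 1 (((D : ℝ) - d) / α)
  have hqp : q < p := max_lt hp hMp
  set C := ENNReal.ofReal (p - ((D : ℝ) - d) / α) * (K * ENNReal.ofReal (5 ^ d) *
        (ENNReal.ofReal (2 ^ q) / volume (ball (0 : EuclideanSpace ℝ (Fin D)) 1))) *
        (2 ^ (p - q) / ENNReal.ofReal (p - q)) with hC
  have hCt : C ≠ ⊤ := by
    refine ENNReal.mul_ne_top (ENNReal.mul_ne_top ofReal_ne_top (ENNReal.mul_ne_top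
      (ENNReal.mul_ne_top coe_ne_top ofReal_ne_top)
      (ENNReal.div_ne_top ofReal_ne_top (measure_ball_pos _ _ one_pos).ne')))
      (ENNReal.div_ne_top (ENNReal.rpow_ne_top_of_nonneg (by linarith) ofNat_ne_top) ?_)
    simpa using hqp
  refine ⟨(C + 1) ^ (1 / p), ENNReal.rpow_pos (by simp) (by simp [hCt]),
    ENNReal.rpow_lt_top_of_nonneg (by positivity) (by simp [hCt]), ?_⟩
  intro e U g hg f hf _
  rw [← ENNReal.mul_rpow_of_nonneg _ _ (by positivity)]
  refine ENNReal.rpow_le_rpow ?_ (by positivity)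
  have hexp : (1 - ((D : ℝ) - d) / (p * α)) * p = p - ((D : ℝ) - d) / α := by
    field_simp
  simp_rw [← ENNReal.rpow_mul, hexp]
  refine (lintegral_avgOp_rpow_le (K := K) ?_ hα (le_max_left _ _)
    ((div_le_iff₀ hα).1 (le_max_right _ _)) hqp hf).trans
    (mul_le_mul_left le_self_add _)
  intro x r hr
  rw [Measure.restrict_apply measurableSet_closedBall]
  exact hK e U g hg x r hr
end

section
/- Define the parabolic Hausdorff pre-measure using parabolic cylinders Q_r(t,x) = (t − r², t] × B_r(x) in ℝ × ℝ^D. Let f ∈ L^p_loc(ℝ × ℝ^D) be nonnegative, p ∈ [1,∞), α > 0, and define Sing_α(f) = { (t,x) : S_α(f)(t,x) = 0 } where S_α uses averages over parabolic cylinders. If 0 < pα < D + 2, then the (D+2−pα)-dimensional parabolic Hausdorff measure of Sing_α(f) is zero; if pα ≥ D + 2, then Sing_α(f) is empty. -/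
open MeasureTheory Metric ENNReal

def pCyl {D : ℕ} (ρ : ℝ) (z : ℝ × EuclideanSpace ℝ (Fin D)) :
    Set (ℝ × EuclideanSpace ℝ (Fin D)) :=
  Set.Ioc (z.1 - ρ ^ 2) z.1 ×ˢ Metric.ball z.2 ρ

noncomputable def cylAvg {D : ℕ} (f : ℝ × EuclideanSpace ℝ (Fin D) → ℝ≥0∞) (ρ : ℝ)
    (z : ℝ × EuclideanSpace ℝ (Fin D)) : ℝ≥0∞ :=
  (∫⁻ w in pCyl ρ z, f w) / volume (pCyl ρ z)

noncomputable def pScale {D : ℕ} (α : ℝ) (f : ℝ × EuclideanSpace ℝ (Fin D) → ℝ≥0∞)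
    (z : ℝ × EuclideanSpace ℝ (Fin D)) : ℝ≥0∞ :=
  sInf {s : ℝ≥0∞ | ∃ ρ : ℝ, 0 < ρ ∧ s = ENNReal.ofReal ρ ∧
    ENNReal.ofReal ρ ^ (-α) < cylAvg f ρ z}

/-- The `β`-dimensional parabolic Hausdorff (outer) measure, defined via countable
covers by parabolic cylinders of radii less than `δ`, letting `δ → 0`. -/
noncomputable def pHaus {D : ℕ} (β : ℝ) (A : Set (ℝ × EuclideanSpace ℝ (Fin D))) : ℝ≥0∞ :=
  ⨆ (δ : ℝ) (_ : 0 < δ),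
    ⨅ (z : ℕ → ℝ × EuclideanSpace ℝ (Fin D)) (r : ℕ → ℝ)
      (_ : ∀ n, 0 < r n ∧ r n < δ) (_ : A ⊆ ⋃ n, pCyl (r n) (z n)),
      ∑' n, ENNReal.ofReal (r n) ^ β

theorem rpow_setLIntegral_le {X : Type*} [MeasurableSpace X] {μ : Measure X}
    {g : X → ℝ≥0∞} (hg : Measurable g) {p : ℝ} (hp : 1 ≤ p) {s : Set X}
    (hs0 : μ s ≠ 0) (hs : μ s ≠ ⊤) :
    ((∫⁻ w in s, g w ∂μ) / μ s) ^ p * μ s ≤ ∫⁻ w in s, g w ^ p ∂μ := by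
  have hp0 : 0 < p := by linarith
  have h := eLpNorm'_le_eLpNorm'_mul_rpow_measure_univ (μ := μ.restrict s) zero_lt_one hp
    hg.aestronglyMeasurable
  simp only [eLpNorm', enorm_eq_self, ENNReal.rpow_one, div_one, Measure.restrict_apply_univ,
    one_div] at h
  have h2 := ENNReal.rpow_le_rpow h hp0.le
  rw [ENNReal.mul_rpow_of_nonneg _ _ hp0.le, ← ENNReal.rpow_mul, ← ENNReal.rpow_mul,
    inv_mul_cancel₀ hp0.ne', ENNReal.rpow_one, sub_mul, inv_mul_cancel₀ hp0.ne',
    one_mul, ENNReal.rpow_sub _ _ hs0 hs, ENNReal.rpow_one] at h2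
  rw [ENNReal.div_rpow_of_nonneg _ _ hp0.le]
  have hsp0 : μ s ^ p ≠ 0 := by simp [hs0, hs]
  have hsp : μ s ^ p ≠ ⊤ := by simp [hs0, hs]
  calc (∫⁻ w in s, g w ∂μ) ^ p / μ s ^ p * μ s
      ≤ (∫⁻ w in s, g w ^ p ∂μ) * (μ s ^ p / μ s) / μ s ^ p * μ s := by gcongr
    _ = (∫⁻ w in s, g w ^ p ∂μ) * ((μ s ^ p * (μ s ^ p)⁻¹) * ((μ s)⁻¹ * μ s)) := by
        simp only [div_eq_mul_inv]; ring
    _ = _ := by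
        rw [ENNReal.mul_inv_cancel hsp0 hsp, ENNReal.inv_mul_cancel hs0 hs, one_mul, mul_one]

theorem measurableSet_pCyl {D : ℕ} (ρ : ℝ) (z : ℝ × EuclideanSpace ℝ (Fin D)) :
    MeasurableSet (pCyl ρ z) :=
  measurableSet_Ioc.prod measurableSet_ball

theorem volume_pCyl {D : ℕ} {ρ : ℝ} (hρ : 0 < ρ) (z : ℝ × EuclideanSpace ℝ (Fin D)) :
    volume (pCyl ρ z) = ENNReal.ofReal ρ ^ ((D : ℝ) + 2) *
      volume (ball (0 : EuclideanSpace ℝ (Fin D)) 1) := by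
  rw [pCyl, Measure.volume_eq_prod, Measure.prod_prod, Real.volume_Ioc,
    Measure.addHaar_ball_of_pos _ _ hρ, finrank_euclideanSpace_fin, _root_.sub_sub_cancel,
    ENNReal.ofReal_pow hρ.le, ENNReal.ofReal_pow hρ.le,
    ENNReal.rpow_add _ _ (by simpa using hρ) ENNReal.ofReal_ne_top, ENNReal.rpow_natCast,
    ENNReal.rpow_ofNat]
  ring

theorem mem_pCyl_self {D : ℕ} {ρ : ℝ} (hρ : 0 < ρ) (z : ℝ × EuclideanSpace ℝ (Fin D)) :
    z ∈ pCyl ρ z :=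
  ⟨⟨by nlinarith, le_rfl⟩, mem_ball_self hρ⟩

theorem nonempty_interior_pCyl {D : ℕ} {ρ : ℝ} (hρ : 0 < ρ)
    (z : ℝ × EuclideanSpace ℝ (Fin D)) : (interior (pCyl ρ z)).Nonempty := by
  rw [pCyl, interior_prod_eq, interior_Ioc, isOpen_ball.interior_eq]
  exact (Set.nonempty_Ioo.2 (by nlinarith)).prod (nonempty_ball.2 hρ)

theorem pCyl_subset_closedBall {D : ℕ} {ρ : ℝ} (hρ : 0 < ρ) (hρ1 : ρ ≤ 1)
    (z : ℝ × EuclideanSpace ℝ (Fin D)) : pCyl ρ z ⊆ closedBall z 1 := by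
  rintro ⟨t, x⟩ ⟨⟨h1, h2⟩, h3⟩
  simp only [mem_ball] at h1 h2 h3
  rw [mem_closedBall, Prod.dist_eq, max_le_iff, Real.dist_eq, abs_le]
  exact ⟨⟨by simp only; nlinarith, by simp only; nlinarith⟩, (h3.trans_le hρ1).le⟩

/-- A cylinder meeting another one of at least half its radius has its centre in a
threefold enlargement of the latter, shifted forward in time. -/
theorem mem_pCyl_of_inter_nonempty {D : ℕ} {r s : ℝ} {y z : ℝ × EuclideanSpace ℝ (Fin D)}
    (hr : 0 < r) (hrs : r ≤ 2 * s) (h : (pCyl r y ∩ pCyl s z).Nonempty) :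
    y ∈ pCyl (3 * s) (z.1 + 4 * s ^ 2, z.2) := by
  obtain ⟨w, ⟨⟨h1, h2⟩, h3⟩, ⟨h4, h5⟩, h6⟩ := h
  refine ⟨⟨?_, ?_⟩, ?_⟩
  · simp only; nlinarith
  · simp only; nlinarith
  · rw [mem_ball] at *
    have := dist_triangle_left y.2 z.2 w.2
    linarith

theorem exists_lt_rpow_le_cylAvg {D : ℕ} {α : ℝ} {f : ℝ × EuclideanSpace ℝ (Fin D) → ℝ≥0∞}
    {z : ℝ × EuclideanSpace ℝ (Fin D)} (hz : pScale α f z = 0) {δ : ℝ} (hδ : 0 < δ) :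
    ∃ ρ : ℝ, 0 < ρ ∧ ρ < δ ∧ ENNReal.ofReal ρ ^ (-α) < cylAvg f ρ z := by
  have h : pScale α f z < ENNReal.ofReal δ := by simpa [hz] using hδ
  obtain ⟨s, ⟨ρ, hρ, rfl, hs⟩, hlt⟩ := sInf_lt_iff.1 h
  exact ⟨ρ, hρ, (ENNReal.ofReal_lt_ofReal_iff hδ).1 hlt, hs⟩

theorem rpow_mul_le_setLIntegral_pCyl {D : ℕ} {g : ℝ × EuclideanSpace ℝ (Fin D) → ℝ≥0∞}
    (hg : Measurable g) {p α ρ : ℝ} (hp : 1 ≤ p) (hρ : 0 < ρ)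
    {z : ℝ × EuclideanSpace ℝ (Fin D)} {c : ℝ≥0∞}
    (h : ENNReal.ofReal ρ ^ (-α) * c ≤ cylAvg g ρ z) :
    ENNReal.ofReal ρ ^ ((D : ℝ) + 2 - p * α) *
        (c ^ p * volume (ball (0 : EuclideanSpace ℝ (Fin D)) 1)) ≤
      ∫⁻ w in pCyl ρ z, g w ^ p := by
  have hρ0 : ENNReal.ofReal ρ ≠ 0 := by simpa using hρ
  have hb0 : volume (ball (0 : EuclideanSpace ℝ (Fin D)) 1) ≠ 0 :=
    (measure_ball_pos _ _ one_pos).ne'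
  have hv := volume_pCyl hρ z
  have hv0 : volume (pCyl ρ z) ≠ 0 := by
    rw [hv]
    exact mul_ne_zero (by simp [ENNReal.rpow_eq_zero_iff, hρ0]) hb0
  have hvt : volume (pCyl ρ z) ≠ ⊤ := by
    rw [hv]
    exact ENNReal.mul_ne_top (ENNReal.rpow_ne_top_of_nonneg (by positivity) ENNReal.ofReal_ne_top)
      measure_ball_lt_top.ne
  refine le_trans ?_ (rpow_setLIntegral_le hg hp hv0 hvt)
  calc _ = (ENNReal.ofReal ρ ^ (-α) * c) ^ p * volume (pCyl ρ z) := by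
        rw [hv, ENNReal.mul_rpow_of_nonneg _ _ (by linarith), ← ENNReal.rpow_mul,
          show (D : ℝ) + 2 - p * α = -α * p + (D + 2) by ring,
          ENNReal.rpow_add _ _ hρ0 ENNReal.ofReal_ne_top]
        ring
    _ ≤ _ := by
        gcongr
        exact h

theorem exists_pos_le_imp_le_rpow_neg {α : ℝ} (hα : 0 < α) {L : ℝ≥0∞} (hL : L ≠ ⊤) :
    ∃ δ : ℝ, 0 < δ ∧ ∀ ρ : ℝ, 0 < ρ → ρ ≤ δ → L ≤ ENNReal.ofReal ρ ^ (-α) := by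
  lift L to NNReal using hL
  refine ⟨((L : ℝ) + 1) ^ (-α)⁻¹, by positivity, fun ρ hρ h => ?_⟩
  rw [ENNReal.ofReal_rpow_of_pos hρ, ← ENNReal.ofReal_coe_nnreal]
  apply ENNReal.ofReal_le_ofReal
  have := (Real.le_rpow_inv_iff_of_neg hρ (by positivity) (by linarith)).1 h
  linarith

/-- A function in `L^p` splits into a bounded part and a part of small `L^p` norm. -/
theorem exists_le_const_add_of_lintegral_rpow_lt_top {X : Type*} [MeasurableSpace X]
    {μ : Measure X} {f : X → ℝ≥0∞} (hf : Measurable f) {p : ℝ} (hp : 0 < p)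
    (h : ∫⁻ x, f x ^ p ∂μ < ⊤) {ε : ℝ≥0∞} (hε : ε ≠ 0) :
    ∃ (L : ℝ≥0∞) (g : X → ℝ≥0∞), L ≠ ⊤ ∧ Measurable g ∧ (∀ x, f x ≤ L + g x) ∧
      ∫⁻ x, g x ^ p ∂μ ≤ ε := by
  obtain ⟨δ, hδ, H⟩ := exists_pos_setLIntegral_lt_of_measure_lt h.ne hε
  obtain ⟨n, hn⟩ := ENNReal.exists_nat_mul_gt hδ.ne' h.ne
  have hfp : Measurable fun x => f x ^ p := hf.pow_const p
  have hs : MeasurableSet {x | (n : ℝ≥0∞) ≤ f x ^ p} := measurableSet_le measurable_const hfp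
  have hsmall : μ {x | (n : ℝ≥0∞) ≤ f x ^ p} < δ := by
    by_contra! hc
    have := mul_meas_ge_le_lintegral (μ := μ) hfp n
    have h3 : (n : ℝ≥0∞) * δ ≤ n * μ {x | (n : ℝ≥0∞) ≤ f x ^ p} := by gcongr
    exact absurd hn (h3.trans this).not_gt
  refine ⟨(n : ℝ≥0∞) ^ p⁻¹, Set.indicator {x | (n : ℝ≥0∞) ≤ f x ^ p} f,
    ENNReal.rpow_ne_top_of_nonneg (by positivity) (by simp), hf.indicator hs, fun x => ?_, ?_⟩
  · by_cases hx : (n : ℝ≥0∞) ≤ f x ^ p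
    · rw [Set.indicator_of_mem (by exact hx)]
      exact le_add_self
    · exact le_add_right ((ENNReal.le_rpow_inv_iff hp).2 (not_le.1 hx).le)
  · have : (fun x => Set.indicator {x | (n : ℝ≥0∞) ≤ f x ^ p} f x ^ p) =
        Set.indicator {x | (n : ℝ≥0∞) ≤ f x ^ p} (fun x => f x ^ p) := by
      ext x
      by_cases hx : (n : ℝ≥0∞) ≤ f x ^ p <;> simp [Set.indicator, hx, hp]
    rw [this, lintegral_indicator hs]
    exact (H _ hsmall).le

theorem cylAvg_le_const_add {D : ℕ} {f g : ℝ × EuclideanSpace ℝ (Fin D) → ℝ≥0∞} {L : ℝ≥0∞}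
    (h : ∀ x, f x ≤ L + g x) (ρ : ℝ) (z : ℝ × EuclideanSpace ℝ (Fin D)) :
    cylAvg f ρ z ≤ L + cylAvg g ρ z := by
  unfold cylAvg
  calc (∫⁻ w in pCyl ρ z, f w) / volume (pCyl ρ z)
      ≤ (∫⁻ w in pCyl ρ z, (L + g w)) / volume (pCyl ρ z) := by
        gcongr with w
        exact h w
    _ = L * (volume (pCyl ρ z) / volume (pCyl ρ z)) + cylAvg g ρ z := by
        rw [lintegral_add_left measurable_const, setLIntegral_const, ENNReal.add_div, mul_div_assoc,
          cylAvg]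
    _ ≤ L + cylAvg g ρ z := by
        gcongr
        exact mul_le_of_le_one_right' ENNReal.div_self_le_one

/-- A set that is a countable union of sets with arbitrarily fine and arbitrarily small countable
covers by cylinders is null for the parabolic Hausdorff measure. -/
theorem pHaus_iUnion_eq_zero {D : ℕ} {β : ℝ} (hβ : 0 < β)
    {A : ℕ → Set (ℝ × EuclideanSpace ℝ (Fin D))}
    (H : ∀ (k : ℕ) (ε : ℝ≥0∞), ε ≠ 0 → ∀ δ : ℝ, 0 < δ →
      ∃ (u : Set (ℝ × EuclideanSpace ℝ (Fin D)))
        (z : ℝ × EuclideanSpace ℝ (Fin D) → ℝ × EuclideanSpace ℝ (Fin D))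
        (r : ℝ × EuclideanSpace ℝ (Fin D) → ℝ), u.Countable ∧ (∀ i ∈ u, 0 < r i ∧ r i < δ) ∧
        A k ⊆ ⋃ i ∈ u, pCyl (r i) (z i) ∧ ∑' i : u, ENNReal.ofReal (r i) ^ β ≤ ε) :
    pHaus β (⋃ k, A k) = 0 := by
  simp only [pHaus, ENNReal.iSup_eq_zero]
  intro δ hδ
  refine le_antisymm (le_of_forall_gt fun ε hε => ?_) zero_le
  have hε2 : ε / 2 ≠ 0 := (ENNReal.half_pos hε.ne').ne'
  obtain ⟨e, he, hesum⟩ := ENNReal.exists_pos_sum_of_countable' hε2 ℕ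
  choose u z r hu hr hA hsum using fun k => H k (e k) (he k).ne' δ hδ
  have hs : ∀ k : ℕ, ∃ s : ℝ, 0 < s ∧ s < δ ∧ ENNReal.ofReal s ^ β ≤ e k := by
    intro k
    obtain ⟨η, hη, hη2⟩ : ∃ η : ℝ, 0 < η ∧ ENNReal.ofReal η ≤ e k ^ β⁻¹ := by
      have : 0 < e k ^ β⁻¹ := by
        rw [pos_iff_ne_zero, Ne, ENNReal.rpow_eq_zero_iff]
        simp [(he k).ne', hβ.le]
      obtain ⟨q, hq0, hq⟩ := ENNReal.lt_iff_exists_nnreal_btwn.1 this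
      exact ⟨q, by exact_mod_cast hq0, by simpa using hq.le⟩
    refine ⟨min η (δ / 2), by positivity, (min_le_right _ _).trans_lt (by linarith), ?_⟩
    rw [← ENNReal.le_rpow_inv_iff hβ]
    exact (ENNReal.ofReal_le_ofReal (min_le_left _ _)).trans hη2
  choose s hs0 hsδ hse using hs
  have := fun k => (hu k).to_subtype
  obtain ⟨φ⟩ : Nonempty (ℕ ≃ (Σ k, u k) ⊕ ℕ) := nonempty_equiv_of_countable
  let Z : (Σ k, u k) ⊕ ℕ → ℝ × EuclideanSpace ℝ (Fin D) := Sum.elim (fun i => z i.1 i.2) 0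
  let R : (Σ k, u k) ⊕ ℕ → ℝ := Sum.elim (fun i => r i.1 i.2) s
  have hR : ∀ i, 0 < R i ∧ R i < δ := by
    rintro (i | k)
    · exact hr i.1 i.2 i.2.2
    · exact ⟨hs0 k, hsδ k⟩
  have hcov : (⋃ k, A k) ⊆ ⋃ n, pCyl (R (φ n)) (Z (φ n)) := by
    intro y hy
    obtain ⟨k, hk⟩ := Set.mem_iUnion.1 hy
    obtain ⟨i, hi, hyi⟩ := Set.mem_iUnion₂.1 (hA k hk)
    refine Set.mem_iUnion.2 ⟨φ.symm (Sum.inl ⟨k, i, hi⟩), ?_⟩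
    rw [Equiv.apply_symm_apply]
    exact hyi
  refine lt_of_le_of_lt (iInf₂_le_of_le (fun n => Z (φ n)) (fun n => R (φ n)) <|
    iInf₂_le_of_le (fun n => hR (φ n)) hcov le_rfl) ?_
  rw [φ.tsum_eq (fun i => ENNReal.ofReal (R i) ^ β),
    Summable.tsum_sum ENNReal.summable ENNReal.summable, ENNReal.tsum_sigma',
    ← ENNReal.add_halves ε]
  exact ENNReal.add_lt_add ((ENNReal.tsum_le_tsum hsum).trans_lt hesum)
    ((ENNReal.tsum_le_tsum hse).trans_lt hesum)

theorem exists_cover_singular_inter_closedBall {D : ℕ}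
    {f : ℝ × EuclideanSpace ℝ (Fin D) → ℝ≥0∞} (hf : Measurable f) {p α : ℝ} (hp : 1 ≤ p)
    (hα : 0 < α) (hβ : p * α < (D : ℝ) + 2) {R : ℝ}
    (hloc : ∫⁻ w in closedBall 0 (R + 1), f w ^ p < ⊤) {ε : ℝ≥0∞} (hε : ε ≠ 0) {δ : ℝ}
    (hδ : 0 < δ) :
    ∃ (u : Set (ℝ × EuclideanSpace ℝ (Fin D)))
      (z : ℝ × EuclideanSpace ℝ (Fin D) → ℝ × EuclideanSpace ℝ (Fin D))
      (r : ℝ × EuclideanSpace ℝ (Fin D) → ℝ), u.Countable ∧ (∀ i ∈ u, 0 < r i ∧ r i < δ) ∧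
      {y | pScale α f y = 0} ∩ closedBall 0 R ⊆ ⋃ i ∈ u, pCyl (r i) (z i) ∧
      ∑' i : u, ENNReal.ofReal (r i) ^ ((D : ℝ) + 2 - p * α) ≤ ε := by
  set β := (D : ℝ) + 2 - p * α with hβdef
  have hβ0 : 0 < β := by linarith
  have hp0 : 0 < p := by linarith
  set c : ℝ≥0∞ := 2⁻¹ ^ p * volume (ball (0 : EuclideanSpace ℝ (Fin D)) 1) with hc
  have hc0 : c ≠ 0 := mul_ne_zero (by simp [ENNReal.rpow_eq_zero_iff])
    (measure_ball_pos _ _ one_pos).ne'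
  have hct : c ≠ ⊤ := ENNReal.mul_ne_top
    (ENNReal.rpow_ne_top_of_nonneg hp0.le (by simp)) measure_ball_lt_top.ne
  have h30 : (3 : ℝ≥0∞) ^ β ≠ 0 := by simp [ENNReal.rpow_eq_zero_iff]
  have h3t : (3 : ℝ≥0∞) ^ β ≠ ⊤ := ENNReal.rpow_ne_top_of_nonneg hβ0.le (by simp)
  have hη : ε * c / 3 ^ β ≠ 0 := (ENNReal.div_pos (mul_ne_zero hε hc0) h3t).ne'
  obtain ⟨L, g, hL, hg, hfg, hgint⟩ :=
    exists_le_const_add_of_lintegral_rpow_lt_top hf hp0 hloc hη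
  obtain ⟨δ₁, hδ₁, hbig⟩ := exists_pos_le_imp_le_rpow_neg hα
    (ENNReal.mul_ne_top hL (by simp : (2 : ℝ≥0∞) ≠ ⊤))
  set S := {y | pScale α f y = 0} ∩ closedBall (0 : ℝ × EuclideanSpace ℝ (Fin D)) R with hS
  have key : ∀ y, ∃ ρ : ℝ, y ∈ S → 0 < ρ ∧ ρ < δ / 3 ∧ ρ ≤ 1 ∧
      ENNReal.ofReal ρ ^ β * c ≤ ∫⁻ w in pCyl ρ y, g w ^ p := by
    intro y
    by_cases hy : y ∈ S
    swap
    · exact ⟨0, fun h => absurd h hy⟩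
    obtain ⟨ρ, hρ, hρlt, hav⟩ := exists_lt_rpow_le_cylAvg hy.1
      (show 0 < min (δ / 3) (min δ₁ 1) by positivity)
    simp only [lt_min_iff] at hρlt
    refine ⟨ρ, fun _ => ⟨hρ, hρlt.1, hρlt.2.2.le, rpow_mul_le_setLIntegral_pCyl hg hp hρ ?_⟩⟩
    have h1 := hbig ρ hρ hρlt.2.1.le
    rw [← div_eq_mul_inv]
    by_contra! hlt
    have h2 : L ≤ ENNReal.ofReal ρ ^ (-α) / 2 := by
      rwa [ENNReal.le_div_iff_mul_le (by simp) (by simp)]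
    have h3 := hav.trans_le (cylAvg_le_const_add hfg ρ y)
    have h4 := ENNReal.add_lt_add_of_le_of_lt hL h2 hlt
    rw [ENNReal.add_halves] at h4
    exact lt_asymm h3 h4
  choose ρ hρ using key
  obtain ⟨u, huS, hdisj, hcov⟩ := Vitali.exists_disjoint_subfamily_covering_enlargement
    (fun y => pCyl (ρ y) y) S ρ 2 one_lt_two (fun a ha => (hρ a ha).1.le) 1
    (fun a ha => (hρ a ha).2.2.1) (fun a ha => ⟨a, mem_pCyl_self (hρ a ha).1 a⟩)
  have huc : u.Countable := hdisj.countable_of_nonempty_interior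
    fun i hi => nonempty_interior_pCyl (hρ i (huS hi)).1 i
  refine ⟨u, fun y => (y.1 + 4 * ρ y ^ 2, y.2), fun y => 3 * ρ y, huc, fun i hi => ?_,
    fun y hy => ?_, ?_⟩
  · have := hρ i (huS hi)
    constructor <;> linarith
  · obtain ⟨b, hb, hne, hle⟩ := hcov y hy
    exact Set.mem_iUnion₂.2 ⟨b, hb, mem_pCyl_of_inter_nonempty (hρ y hy).1 hle hne⟩
  · have hsub : (⋃ i ∈ u, pCyl (ρ i) i) ⊆ closedBall 0 (R + 1) := by
      refine Set.iUnion₂_subset fun i hi => ?_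
      have hi' := hρ i (huS hi)
      refine (pCyl_subset_closedBall hi'.1 hi'.2.2.1 i).trans (closedBall_subset_closedBall' ?_)
      have := mem_closedBall.1 (huS hi).2
      linarith
    have hsum : (∑' i : u, ENNReal.ofReal (ρ i) ^ β) * c ≤ ε * c / 3 ^ β := by
      rw [← ENNReal.tsum_mul_right]
      calc _ ≤ ∑' i : u, ∫⁻ w in pCyl (ρ i) (i : ℝ × EuclideanSpace ℝ (Fin D)), g w ^ p :=
            ENNReal.tsum_le_tsum fun i => (hρ i (huS i.2)).2.2.2
        _ = ∫⁻ w in ⋃ i ∈ u, pCyl (ρ i) i, g w ^ p :=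
            (lintegral_biUnion huc (fun i _ => measurableSet_pCyl _ _) hdisj _).symm
        _ ≤ ∫⁻ w in closedBall 0 (R + 1), g w ^ p := lintegral_mono_set hsub
        _ ≤ _ := hgint
    rw [ENNReal.le_div_iff_mul_le (Or.inl h30) (Or.inl h3t), mul_right_comm,
      ENNReal.mul_le_mul_iff_left hc0 hct, ← ENNReal.tsum_mul_right] at hsum
    refine le_trans (le_of_eq (tsum_congr fun i => ?_)) hsum
    rw [ENNReal.ofReal_mul (by norm_num), ENNReal.mul_rpow_of_nonneg _ _ hβ0.le, mul_comm]
    norm_num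

theorem stmt11 {D : ℕ} (f : ℝ × EuclideanSpace ℝ (Fin D) → ℝ≥0∞) (hf : Measurable f)
    {p α : ℝ} (hp : 1 ≤ p) (hα : 0 < α)
    (hloc : ∀ K : Set (ℝ × EuclideanSpace ℝ (Fin D)), IsCompact K → ∫⁻ w in K, f w ^ p < ⊤) :
    (p * α < (D : ℝ) + 2 →
      pHaus ((D : ℝ) + 2 - p * α) {z : ℝ × EuclideanSpace ℝ (Fin D) | pScale α f z = 0} = 0) ∧
    ((D : ℝ) + 2 ≤ p * α → {z : ℝ × EuclideanSpace ℝ (Fin D) | pScale α f z = 0} = ∅) := by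
  refine ⟨fun hβ => ?_, fun hβ => Set.eq_empty_iff_forall_notMem.2 fun z hz => ?_⟩
  · have hU : {z : ℝ × EuclideanSpace ℝ (Fin D) | pScale α f z = 0} =
        ⋃ k : ℕ, {z | pScale α f z = 0} ∩ closedBall 0 k := by
      rw [← Set.inter_iUnion, iUnion_closedBall_nat, Set.inter_univ]
    rw [hU]
    exact pHaus_iUnion_eq_zero (by linarith) fun k ε hε δ hδ =>
      exists_cover_singular_inter_closedBall hf hp hα hβ (hloc _ (isCompact_closedBall _ _)) hε hδ
  · set b := volume (ball (0 : EuclideanSpace ℝ (Fin D)) 1) with hb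
    have hb0 : b ≠ 0 := (measure_ball_pos _ _ one_pos).ne'
    have hbt : b ≠ ⊤ := measure_ball_lt_top.ne
    obtain ⟨η, hη, H⟩ := exists_pos_setLIntegral_lt_of_measure_lt
      (hloc _ (isCompact_closedBall z 1)).ne hb0
    obtain ⟨q, hq0, hq⟩ := ENNReal.exists_nnreal_pos_mul_lt hbt hη.ne'
    obtain ⟨ρ, hρ, hρlt, hav⟩ := exists_lt_rpow_le_cylAvg hz
      (show 0 < min (q : ℝ) 1 from lt_min hq0 one_pos)
    obtain ⟨hρq, hρ1⟩ := lt_min_iff.1 hρlt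
    have hρ1' : ENNReal.ofReal ρ ≤ 1 := by simpa using hρ1.le
    have hsub := pCyl_subset_closedBall hρ hρ1.le z
    have hvol : volume (pCyl ρ z) < η := by
      rw [volume_pCyl hρ]
      refine lt_of_le_of_lt ?_ hq
      gcongr
      calc ENNReal.ofReal ρ ^ ((D : ℝ) + 2) ≤ ENNReal.ofReal ρ ^ (1 : ℝ) :=
            ENNReal.rpow_le_rpow_of_exponent_ge hρ1' (by linarith [(Nat.cast_nonneg D : (0:ℝ) ≤ D)])
        _ ≤ q := by
            rw [ENNReal.rpow_one, ← ENNReal.ofReal_coe_nnreal]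
            exact ENNReal.ofReal_le_ofReal hρq.le
    have hlt := H (pCyl ρ z) ((Measure.restrict_apply_le _ _).trans_lt hvol)
    rw [Measure.restrict_restrict (measurableSet_pCyl _ _), Set.inter_eq_left.2 hsub] at hlt
    have hge := rpow_mul_le_setLIntegral_pCyl hf hp hρ (c := 1) (by simpa using hav.le)
    rw [ENNReal.one_rpow, one_mul] at hge
    refine absurd (hge.trans_lt hlt) (not_lt.2 ?_)
    have h1 : 1 ≤ ENNReal.ofReal ρ ^ ((D : ℝ) + 2 - p * α) := by
      rw [← ENNReal.rpow_zero (x := ENNReal.ofReal ρ)]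
      exact ENNReal.rpow_le_rpow_of_exponent_ge hρ1' (by linarith)
    exact le_mul_of_one_le_left' h1
end
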